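/- arXiv:1805.05025 — 2 statements merged into one kernel-verified Lean document; each statement's English description precedes it below -/
import Mathlib

section
/- Consider any σ_*, σ'_* ∈ S_*(1/(4Q)), and let T := ⌈(1/2)·n·log n⌉. There exists a constant C_G > 0 depending only on G such that for any given R > 0, the product replacement chain started at σ'_* satisfies Pr_{σ'_*}(σ_T ∉ S_*(σ_*, R/√n)) ≤ C_G·e^{−R} + 1/n for all large enough n. -/
open scoped BigOperators
open Filter

attribute [local instance] Classical.propDecidable

noncomputable section

namespace PR

variable (G : Type) [Group G] [Fintype G]

/-- A configuration: an `n`-tuple of elements of `G`. -/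
abbrev Config (n : ℕ) := Fin n → G

/-- The set of generating `n`-tuples. -/
def gens (n : ℕ) : Set (Config G n) :=
  {σ | Subgroup.closure (Set.range σ) = ⊤}

/-- A move of the product replacement chain: an ordered pair of distinct indices
together with a sign (`true` = multiply, `false` = multiply by inverse). -/
abbrev Move (n : ℕ) := {p : Fin n × Fin n // p.1 ≠ p.2} × Bool

/-- Applying a move: replace `σ i` by `σ i * (σ j)^{±1}`. -/
def applyMove {n : ℕ} (σ : Config G n) (m : Move n) : Config G n :=
  Function.update σ m.1.1.1
    (σ m.1.1.1 * (if m.2 then σ m.1.1.2 else (σ m.1.1.2)⁻¹))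

/-- One-step transition probability of the product replacement chain. -/
def step {n : ℕ} (σ σ' : Config G n) : ℝ :=
  ((Finset.univ.filter (fun m : Move n => applyMove G σ m = σ')).card : ℝ) /
    (Fintype.card (Move n) : ℝ)

/-- The law of `σ_t` for the chain started at `σ₀`. -/
def law {n : ℕ} (σ₀ : Config G n) : ℕ → Config G n → ℝ
  | 0 => fun σ' => if σ' = σ₀ then 1 else 0
  | (t + 1) => fun σ' => ∑ τ : Config G n, law σ₀ t τ * step G τ σ'

/-- Probability that `σ_t ∈ E` for the chain started at `σ₀`. -/
def prob {n : ℕ} (σ₀ : Config G n) (t : ℕ) (E : Set (Config G n)) : ℝ :=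
  ∑ τ ∈ Finset.univ.filter (fun τ => τ ∈ E), law G σ₀ t τ

/-- Probability of a trajectory event for the chain started at `σ₀`, over the
time horizon `{0, 1, …, T}`. -/
def pathProb {n : ℕ} (σ₀ : Config G n) (T : ℕ)
    (E : Set (Fin (T + 1) → Config G n)) : ℝ :=
  ∑ p ∈ Finset.univ.filter
      (fun p : Fin (T + 1) → Config G n => p 0 = σ₀ ∧ p ∈ E),
    ∏ t : Fin T, step G (p t.castSucc) (p t.succ)

/-- `n_a(σ)`: the number of sites holding the group element `a`. -/
def nCount {n : ℕ} (σ : Config G n) (a : G) : ℕ :=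
  (Finset.univ.filter (fun i => σ i = a)).card

/-- `n^H_non(σ)`: the number of sites whose element lies outside `H`. -/
def nNon {n : ℕ} (H : Subgroup G) (σ : Config G n) : ℕ :=
  (Finset.univ.filter (fun i => σ i ∉ H)).card

/-- `n^{id}_non(σ)`: the number of sites not holding the identity. -/
def nNonId {n : ℕ} (σ : Config G n) : ℕ :=
  (Finset.univ.filter (fun i => σ i ≠ 1)).card

/-- `S_non(c)`. -/
def SNon (n : ℕ) (c : ℝ) : Set (Config G n) :=
  {σ | σ ∈ gens G n ∧
    ∀ H : Subgroup G, H ≠ ⊤ → c * n ≤ (nNon G H σ : ℝ)}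

/-- The `δ`-typical set `S_*(δ)`. -/
def SAst (n : ℕ) (δ : ℝ) : Set (Config G n) :=
  {σ | σ ∈ gens G n ∧
    Real.sqrt (∑ a : G, ((nCount G σ a : ℝ) / n - 1 / (Fintype.card G : ℝ)) ^ 2) ≤ δ}

/-- `n^{σ₀}_{a,b}(σ)`. -/
def nab {n : ℕ} (σ₀ σ : Config G n) (a b : G) : ℕ :=
  (Finset.univ.filter (fun i => σ₀ i = a ∧ σ i = b)).card

/-- `S_*(σ₀, r)`. -/
def SAstM {n : ℕ} (σ₀ : Config G n) (r : ℝ) : Set (Config G n) :=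
  {σ | σ ∈ gens G n ∧
    ∀ a : G, Real.sqrt (∑ b : G,
      ((nab G σ₀ σ a b : ℝ) / (nCount G σ₀ a : ℝ) - 1 / (Fintype.card G : ℝ)) ^ 2) ≤ r}

/-- The uniform stationary distribution `π` on the set of generating tuples. -/
def statDist (n : ℕ) : Config G n → ℝ := fun σ =>
  if σ ∈ gens G n then
    1 / ((Finset.univ.filter (fun τ : Config G n => τ ∈ gens G n)).card : ℝ)
  else 0

/-- Total-variation distance between two (finitely supported) signed weights,
as the supremum over finite sets `A` of `|p(A) - q(A)|`. -/
def tvDist {α : Type*} (p q : α → ℝ) : ℝ :=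
  sSup {x : ℝ | ∃ A : Finset α, x = |∑ a ∈ A, p a - ∑ a ∈ A, q a|}

/-- `d_σ(t) = max_{A ⊆ S} |P_σ(σ_t ∈ A) - π(A)|`. -/
def dTV {n : ℕ} (σ : Config G n) (t : ℕ) : ℝ :=
  sSup {x : ℝ | ∃ A : Finset (Config G n), ↑A ⊆ gens G n ∧
    x = |∑ τ ∈ A, law G σ t τ - ∑ τ ∈ A, statDist G n τ|}

/-- `max_{σ ∈ S} d_σ(t)`. -/
def dMax (n : ℕ) (t : ℕ) : ℝ :=
  sSup {x : ℝ | ∃ σ ∈ gens G n, x = dTV G σ t}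

end PR

namespace PR

section Averaging

set_option linter.unusedSectionVars false

variable {G : Type} [Group G] [Fintype G] {n : ℕ}

/-- The transition operator of the product replacement chain. -/
def avg (f : Config G n → ℝ) (σ : Config G n) : ℝ :=
  (∑ m : Move n, f (applyMove G σ m)) / (Fintype.card (Move n) : ℝ)

lemma sum_step_mul (f : Config G n → ℝ) (σ : Config G n) :
    ∑ τ, step G σ τ * f τ = avg f σ := by
  simp only [step, avg, div_mul_eq_mul_div, ← Finset.sum_div]
  congr 1
  have h : ∀ τ : Config G n,
      ((Finset.univ.filter (fun m : Move n => applyMove G σ m = τ)).card : ℝ) * f τ =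
        ∑ m : Move n, if applyMove G σ m = τ then f τ else 0 := by
    intro τ
    rw [← Finset.sum_filter, Finset.sum_const, nsmul_eq_mul]
  simp_rw [h]
  rw [Finset.sum_comm]
  simp

lemma step_nonneg (σ τ : Config G n) : 0 ≤ step G σ τ := by
  unfold step; positivity

lemma law_nonneg (σ₀ : Config G n) (t : ℕ) (τ : Config G n) : 0 ≤ law G σ₀ t τ := by
  induction t generalizing τ with
  | zero => simp only [law]; split_ifs <;> norm_num
  | succ t ih => exact Finset.sum_nonneg fun ρ _ => mul_nonneg (ih ρ) (step_nonneg ρ τ)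

lemma sum_law_succ_mul (σ₀ : Config G n) (t : ℕ) (f : Config G n → ℝ) :
    ∑ τ, law G σ₀ (t + 1) τ * f τ = ∑ τ, law G σ₀ t τ * avg f τ := by
  simp only [law, Finset.sum_mul, ← sum_step_mul, Finset.mul_sum]
  rw [Finset.sum_comm]
  simp only [mul_assoc]

lemma sum_law_mul_le (σ₀ : Config G n) (T : ℕ) (F : ℕ → Config G n → ℝ)
    (hF : ∀ t < T, ∀ σ, avg (F (t + 1)) σ ≤ F t σ) :
    ∑ τ, law G σ₀ T τ * F T τ ≤ F 0 σ₀ := by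
  induction T with
  | zero => simp [law]
  | succ T ih =>
    rw [sum_law_succ_mul]
    refine le_trans (Finset.sum_le_sum fun τ _ => ?_) (ih fun t ht => hF t (by omega))
    exact mul_le_mul_of_nonneg_left (hF T (by omega) τ) (law_nonneg _ _ _)

lemma applyMove_mem_gens {σ : Config G n} (hσ : σ ∈ gens G n) (m : Move n) :
    applyMove G σ m ∈ gens G n := by
  obtain ⟨⟨⟨i, j⟩, hij⟩, e⟩ := m
  simp only [ne_eq] at hij
  have hσ' : Subgroup.closure (Set.range σ) = ⊤ := hσ
  change Subgroup.closure (Set.range _) = ⊤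
  rw [eq_top_iff, ← hσ', Subgroup.closure_le]
  set τ := applyMove G σ ⟨⟨⟨i, j⟩, hij⟩, e⟩ with hτ
  have hmem : ∀ k, τ k ∈ Subgroup.closure (Set.range τ) := fun k =>
    Subgroup.subset_closure ⟨k, rfl⟩
  have hne : ∀ k, k ≠ i → τ k = σ k := fun k hk => by
    simp [hτ, applyMove, hk]
  have hi : τ i = σ i * (if e then σ j else (σ j)⁻¹) := by
    simp [hτ, applyMove]
  rintro _ ⟨k, rfl⟩
  by_cases hk : k = i
  · subst hk
    have hj : σ j ∈ Subgroup.closure (Set.range τ) := by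
      rw [← hne j (fun h => hij h.symm)]; exact hmem j
    have h : σ k = τ k * (if e then σ j else (σ j)⁻¹)⁻¹ := by rw [hi]; group
    rw [SetLike.mem_coe, h]
    refine mul_mem (hmem k) (inv_mem ?_)
    split_ifs
    · exact hj
    · exact inv_mem hj
  · rw [← hne k hk]; exact hmem k

lemma law_eq_zero_of_notMem_gens {σ₀ : Config G n} (h₀ : σ₀ ∈ gens G n) (t : ℕ)
    {τ : Config G n} (hτ : τ ∉ gens G n) : law G σ₀ t τ = 0 := by
  induction t generalizing τ with
  | zero =>
    simp only [law, ite_eq_right_iff, one_ne_zero, imp_false]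
    rintro rfl; exact hτ h₀
  | succ t ih =>
    simp only [law]
    refine Finset.sum_eq_zero fun ρ _ => ?_
    by_cases hρ : ρ ∈ gens G n
    · have : Finset.univ.filter (fun m : Move n => applyMove G ρ m = τ) = ∅ := by
        refine Finset.filter_eq_empty_iff.2 fun m _ h => hτ ?_
        rw [← h]; exact applyMove_mem_gens hρ m
      simp [step, this]
    · rw [ih hρ, zero_mul]

/-- The deviation from uniformity of the values of `σ` on the sites of `J`. -/
def dev (J : Finset (Fin n)) (σ : Config G n) (b : G) : ℝ :=
  ((J.filter (fun i => σ i = b)).card : ℝ) / (J.card : ℝ) - 1 / (Fintype.card G : ℝ)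

/-- The squared Euclidean norm of the deviation. -/
def sqDev (J : Finset (Fin n)) (σ : Config G n) : ℝ := ∑ b, dev J σ b ^ 2

/-- A smooth version of the rescaled norm of the deviation. -/
def height (J : Finset (Fin n)) (σ : Config G n) : ℝ := Real.sqrt (1 + n * sqDev J σ)

/-- The `ℓ¹` norm of the deviation over all sites. -/
def absDev (σ : Config G n) : ℝ := ∑ b, |dev Finset.univ σ b|

lemma sum_comp_eq {J : Finset (Fin n)} (hJ : J.Nonempty) (σ : Config G n) (f : G → ℝ) :
    ∑ i ∈ J, f (σ i) = J.card * ∑ b, (dev J σ b + 1 / (Fintype.card G : ℝ)) * f b := by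
  have hJ' : (J.card : ℝ) ≠ 0 := by exact_mod_cast hJ.card_pos.ne'
  rw [← Finset.sum_fiberwise J σ, Finset.mul_sum]
  refine Finset.sum_congr rfl fun b _ => ?_
  rw [Finset.sum_congr rfl (g := fun _ => f b)
    (fun i hi => by rw [(Finset.mem_filter.1 hi).2]), Finset.sum_const, nsmul_eq_mul]
  simp only [dev]
  field_simp
  ring

lemma card_group_pos : (0 : ℝ) < Fintype.card G := by
  exact_mod_cast Fintype.card_pos

lemma sum_dev {J : Finset (Fin n)} (hJ : J.Nonempty) (σ : Config G n) :
    ∑ b, dev J σ b = 0 := by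
  have h := sum_comp_eq hJ σ (fun _ => 1)
  have hJ' : (J.card : ℝ) ≠ 0 := by exact_mod_cast hJ.card_pos.ne'
  have hQ := (card_group_pos (G := G)).ne'
  simp only [Finset.sum_const, nsmul_eq_mul, mul_one, Finset.sum_add_distrib,
    Finset.card_univ] at h
  have h2 : (Fintype.card G : ℝ) * (1 / (Fintype.card G : ℝ)) = 1 := by field_simp
  rw [h2] at h
  have h3 := mul_left_cancel₀ hJ' ((mul_one _).trans h)
  linarith

lemma sqDev_nonneg (J : Finset (Fin n)) (σ : Config G n) : 0 ≤ sqDev J σ :=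
  Finset.sum_nonneg fun _ _ => sq_nonneg _

lemma abs_dev_le (J : Finset (Fin n)) (σ : Config G n) (b : G) :
    |dev J σ b| ≤ Real.sqrt (sqDev J σ) := by
  rw [← Real.sqrt_sq_eq_abs]
  exact Real.sqrt_le_sqrt
    (Finset.single_le_sum (f := fun b => dev J σ b ^ 2) (fun _ _ => sq_nonneg _)
      (Finset.mem_univ b))

lemma sqDev_le_one {J : Finset (Fin n)} (hJ : J.Nonempty) (σ : Config G n) :
    sqDev J σ ≤ 1 := by
  have hQ := card_group_pos (G := G)
  have hJ' : (0 : ℝ) < J.card := by exact_mod_cast hJ.card_pos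
  have h1 : ∀ b, dev J σ b ^ 2 ≤ dev J σ b * (1 - 2 * (1 / (Fintype.card G : ℝ)))
      + (1 / (Fintype.card G : ℝ) - (1 / (Fintype.card G : ℝ)) ^ 2) := by
    intro b
    have hx : dev J σ b + 1 / (Fintype.card G : ℝ) =
      ((J.filter (fun i => σ i = b)).card : ℝ) / (J.card : ℝ) := by simp [dev]
    have h0 : 0 ≤ dev J σ b + 1 / (Fintype.card G : ℝ) := by rw [hx]; positivity
    have h1 : dev J σ b + 1 / (Fintype.card G : ℝ) ≤ 1 := by
      rw [hx, div_le_one hJ']; exact_mod_cast Finset.card_filter_le _ _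
    have h2 : 0 < 1 / (Fintype.card G : ℝ) := by positivity
    nlinarith [mul_nonneg h0 (sub_nonneg.2 h1)]
  refine (Finset.sum_le_sum fun b _ => h1 b).trans ?_
  rw [Finset.sum_add_distrib, ← Finset.sum_mul, sum_dev hJ, zero_mul, zero_add,
    Finset.sum_const, nsmul_eq_mul, Finset.card_univ]
  field_simp
  linarith

lemma absDev_le (σ : Config G n) :
    absDev σ ≤ Real.sqrt (Fintype.card G) * Real.sqrt (sqDev Finset.univ σ) := by
  rw [← Real.sqrt_mul card_group_pos.le]
  refine Real.le_sqrt_of_sq_le ?_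
  have h := sq_sum_le_card_mul_sum_sq (s := (Finset.univ : Finset G))
    (f := fun b => |dev Finset.univ σ b|)
  simpa [sq_abs, absDev, sqDev] using h

lemma one_le_height (J : Finset (Fin n)) (σ : Config G n) : 1 ≤ height J σ := by
  refine Real.one_le_sqrt.2 ?_
  have := sqDev_nonneg J σ
  nlinarith [mul_nonneg (Nat.cast_nonneg (α := ℝ) n) this]

lemma height_sq (J : Finset (Fin n)) (σ : Config G n) :
    height J σ ^ 2 = 1 + n * sqDev J σ := by
  refine Real.sq_sqrt ?_
  have := sqDev_nonneg J σ
  positivity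

lemma sqrt_mul_sqrt_le_height (J : Finset (Fin n)) (σ : Config G n) :
    Real.sqrt n * Real.sqrt (sqDev J σ) ≤ height J σ := by
  rw [← Real.sqrt_mul (Nat.cast_nonneg n)]
  exact Real.sqrt_le_sqrt (by linarith)

lemma height_le (J : Finset (Fin n)) (σ : Config G n) :
    height J σ ≤ 1 + Real.sqrt n * Real.sqrt (sqDev J σ) := by
  refine Real.sqrt_le_iff.2 ⟨by positivity, ?_⟩
  have h1 := Real.sq_sqrt (Nat.cast_nonneg (α := ℝ) n)
  have h2 := Real.sq_sqrt (sqDev_nonneg J σ)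
  have h3 : 0 ≤ Real.sqrt n * Real.sqrt (sqDev J σ) := by positivity
  nlinarith

/-- The autocorrelation of the deviation. -/
def corr (J : Finset (Fin n)) (σ : Config G n) (h : G) : ℝ :=
  ∑ b, dev J σ b * dev J σ (b * h)

lemma abs_corr_le (J : Finset (Fin n)) (σ : Config G n) (h : G) :
    |corr J σ h| ≤ sqDev J σ := by
  have hs : ∑ b, dev J σ (b * h) ^ 2 = sqDev J σ :=
    Equiv.sum_comp (Equiv.mulRight h) (fun b => dev J σ b ^ 2)
  have h1 : ∑ b, (dev J σ b ^ 2 + dev J σ (b * h) ^ 2) / 2 = sqDev J σ := by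
    rw [← Finset.sum_div, Finset.sum_add_distrib, hs]
    simp [sqDev]
  rw [← h1]
  refine (Finset.abs_sum_le_sum_abs _ _).trans (Finset.sum_le_sum fun b _ => ?_)
  rw [abs_le]
  constructor <;> nlinarith [sq_nonneg (dev J σ b + dev J σ (b * h)),
    sq_nonneg (dev J σ b - dev J σ (b * h))]

lemma sum_corr {J : Finset (Fin n)} (hJ : J.Nonempty) (σ : Config G n) :
    ∑ h, corr J σ h = 0 := by
  simp only [corr]
  rw [Finset.sum_comm]
  refine Finset.sum_eq_zero fun b _ => ?_
  have h : ∑ h, dev J σ (b * h) = 0 :=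
    (Equiv.sum_comp (Equiv.mulLeft b) (fun h => dev J σ h)).trans (sum_dev hJ σ)
  rw [← Finset.mul_sum, h, mul_zero]

lemma sum_dev_mul_right {J : Finset (Fin n)} (hJ : J.Nonempty) (σ : Config G n) (h : G) :
    ∑ i ∈ J, dev J σ (σ i * h) = J.card * corr J σ h := by
  rw [sum_comp_eq hJ σ (fun b => dev J σ (b * h))]
  simp only [add_mul, Finset.sum_add_distrib, ← Finset.mul_sum]
  have h0 : ∑ b, dev J σ (b * h) = 0 :=
    (Equiv.sum_comp (Equiv.mulRight h) (fun b => dev J σ b)).trans (sum_dev hJ σ)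
  simp [corr, h0]

lemma sum_dev_apply {J : Finset (Fin n)} (hJ : J.Nonempty) (σ : Config G n) :
    ∑ i ∈ J, dev J σ (σ i) = J.card * sqDev J σ := by
  have h := sum_dev_mul_right hJ σ 1
  simpa [corr, sqDev, sq] using h

/-- Averaging a bounded, mean-zero function along a configuration. -/
lemma sum_apply_le [NeZero n] (σ : Config G n) (f : G → ℝ) (hf : ∑ g, f g = 0) {B : ℝ}
    (hB : ∀ g, |f g| ≤ B) : ∑ j, f (σ j) ≤ n * (absDev σ * B) := by
  have hu : (Finset.univ : Finset (Fin n)).Nonempty := Finset.univ_nonempty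
  rw [sum_comp_eq hu σ f]
  simp only [Finset.card_univ, Fintype.card_fin]
  refine mul_le_mul_of_nonneg_left ?_ (Nat.cast_nonneg n)
  simp only [add_mul, Finset.sum_add_distrib, ← Finset.mul_sum, hf, mul_zero, add_zero]
  rw [absDev, Finset.sum_mul]
  refine Finset.sum_le_sum fun b _ => ?_
  calc dev Finset.univ σ b * f b ≤ |dev Finset.univ σ b * f b| := le_abs_self _
    _ = |dev Finset.univ σ b| * |f b| := abs_mul _ _
    _ ≤ _ := mul_le_mul_of_nonneg_left (hB b) (abs_nonneg _)

lemma dev_update {J : Finset (Fin n)} (σ : Config G n) (i : Fin n) (x b : G) :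
    dev J (Function.update σ i x) b = dev J σ b +
      if i ∈ J then ((if x = b then 1 else 0) - (if σ i = b then 1 else 0)) / (J.card : ℝ)
      else 0 := by
  have hc : ∀ τ : Config G n, ((J.filter (fun k => τ k = b)).card : ℝ) =
      ∑ k ∈ J, if τ k = b then (1 : ℝ) else 0 := by
    intro τ; simp
  simp only [dev, hc]
  split_ifs with hi
  all_goals first
    | (rw [← Finset.add_sum_erase _ _ hi, ← Finset.add_sum_erase _ _ hi]
       rw [Finset.sum_congr (s₁ := J.erase i) rfl
         (g := fun k => if σ k = b then (1 : ℝ) else 0)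
         (fun k hk => by simp [Function.update_of_ne (Finset.ne_of_mem_erase hk)])]
       simp_all
       try ring)
    | (rw [Finset.sum_congr (s₁ := J) rfl
         (g := fun k => if σ k = b then (1 : ℝ) else 0)
         (fun k hk => by simp [Function.update_of_ne (show k ≠ i by rintro rfl; exact hi hk)])]
       ring)

lemma sqDev_update {J : Finset (Fin n)} (σ : Config G n) {i : Fin n} (hi : i ∈ J) (x : G) :
    sqDev J σ + 2 * (dev J σ x - dev J σ (σ i)) / (J.card : ℝ) ≤
        sqDev J (Function.update σ i x) ∧
      sqDev J (Function.update σ i x) ≤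
        sqDev J σ + 2 * (dev J σ x - dev J σ (σ i)) / (J.card : ℝ) + 2 / (J.card : ℝ) ^ 2 := by
  set d : G → ℝ := fun b => ((if x = b then 1 else 0) - (if σ i = b then 1 else 0)) with hd
  have hsum : sqDev J (Function.update σ i x) =
      sqDev J σ + 2 * (dev J σ x - dev J σ (σ i)) / (J.card : ℝ)
        + (∑ b, d b ^ 2) / (J.card : ℝ) ^ 2 := by
    have h1 : ∑ b, dev J σ b * d b = dev J σ x - dev J σ (σ i) := by
      simp [hd, mul_sub, Finset.sum_sub_distrib]
    rw [← h1]
    simp only [sqDev, dev_update, if_pos hi]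
    rw [Finset.mul_sum, Finset.sum_div, Finset.sum_div, ← Finset.sum_add_distrib,
      ← Finset.sum_add_distrib]
    refine Finset.sum_congr rfl fun b _ => ?_
    simp only [hd]
    ring
  have h2 : ∑ b, d b ^ 2 ≤ 2 := by
    have h3 : ∑ b, ((if x = b then 1 else 0) + (if σ i = b then 1 else 0) : ℝ) = 2 := by
      simp [Finset.sum_add_distrib]; norm_num
    rw [← h3]
    refine Finset.sum_le_sum fun b _ => ?_
    simp only [hd]
    split_ifs <;> norm_num
  have h4 : 0 ≤ ∑ b, d b ^ 2 := Finset.sum_nonneg fun _ _ => sq_nonneg _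
  rw [hsum]
  constructor
  · have : 0 ≤ (∑ b, d b ^ 2) / (J.card : ℝ) ^ 2 := by positivity
    linarith
  · gcongr

/-- The first-order change of `sqDev J` along a move. -/
def drift (J : Finset (Fin n)) (σ : Config G n) (i j : Fin n) (e : Bool) : ℝ :=
  if i ∈ J then
    2 * (dev J σ (σ i * (if e then σ j else (σ j)⁻¹)) - dev J σ (σ i)) / (J.card : ℝ)
  else 0

lemma sqDev_applyMove (J : Finset (Fin n)) (σ : Config G n) (m : Move n) :
    sqDev J σ + drift J σ m.1.1.1 m.1.1.2 m.2 ≤ sqDev J (applyMove G σ m) ∧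
      sqDev J (applyMove G σ m) ≤
        sqDev J σ + drift J σ m.1.1.1 m.1.1.2 m.2 + 2 / (J.card : ℝ) ^ 2 := by
  by_cases hi : m.1.1.1 ∈ J
  · simp only [drift, if_pos hi, applyMove]
    exact sqDev_update σ hi _
  · have h : sqDev J (applyMove G σ m) = sqDev J σ := by
      simp [sqDev, applyMove, dev_update, hi]
    simp only [drift, if_neg hi, h, add_zero, le_refl, true_and]
    have : 0 ≤ 2 / (J.card : ℝ) ^ 2 := by positivity
    linarith

lemma abs_drift_le (J : Finset (Fin n)) (σ : Config G n) (i j : Fin n) (e : Bool) :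
    |drift J σ i j e| ≤ 4 * Real.sqrt (sqDev J σ) / (J.card : ℝ) := by
  unfold drift
  split_ifs with hi
  all_goals first
    | (rw [abs_div, Nat.abs_cast]
       refine div_le_div_of_nonneg_right ?_ (Nat.cast_nonneg _)
       rw [abs_mul, abs_two]
       have h1 := abs_sub (dev J σ (σ i * σ j)) (dev J σ (σ i))
       have h1' := abs_sub (dev J σ (σ i * (σ j)⁻¹)) (dev J σ (σ i))
       have h2 := abs_dev_le J σ (σ i * σ j)
       have h2' := abs_dev_le J σ (σ i * (σ j)⁻¹)
       have h3 := abs_dev_le J σ (σ i)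
       linarith)
    | (rw [abs_zero]; positivity)

lemma sum_move (F : Fin n → Fin n → Bool → ℝ) :
    ∑ m : Move n, F m.1.1.1 m.1.1.2 m.2 =
      ∑ i, ∑ j, (F i j true + F i j false) - ∑ i, (F i i true + F i i false) := by
  rw [Fintype.sum_prod_type]
  simp only [Fintype.sum_bool]
  set f : Fin n × Fin n → ℝ := fun p => F p.1 p.2 true + F p.1 p.2 false with hf
  have h1 : ∑ p ∈ Finset.univ.filter (fun p : Fin n × Fin n => p.1 ≠ p.2), f p =
      ∑ p : {p : Fin n × Fin n // p.1 ≠ p.2}, f p.1 :=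
    Finset.sum_subtype _ (by simp) f
  have h2 := Finset.sum_filter_add_sum_filter_not Finset.univ
    (fun p : Fin n × Fin n => p.1 ≠ p.2) f
  have h3 : ∑ p ∈ Finset.univ.filter (fun p : Fin n × Fin n => ¬ p.1 ≠ p.2), f p =
      ∑ i, (F i i true + F i i false) := by
    rw [Finset.sum_filter, Fintype.sum_prod_type]
    simp [hf]
  rw [Fintype.sum_prod_type, h3, h1] at h2
  linarith

lemma card_move : (Fintype.card (Move n) : ℝ) = 2 * n * (n - 1) := by
  have h := sum_move (n := n) (fun _ _ _ => 1)
  simp only [Finset.sum_const, Finset.card_univ, nsmul_eq_mul, Fintype.card_fin, mul_one] at h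
  rw [h]; ring

lemma sum_drift_le [NeZero n] {J : Finset (Fin n)} (hJ : J.Nonempty) (σ : Config G n) :
    ∑ m : Move n, drift J σ m.1.1.1 m.1.1.2 m.2 ≤
      - (4 * n * ((1 - absDev σ) * sqDev J σ)) + 8 := by
  have hm : (0 : ℝ) < J.card := by exact_mod_cast hJ.card_pos
  rw [sum_move (drift J σ)]
  have hdiag : - ∑ i, (drift J σ i i true + drift J σ i i false) ≤ 8 := by
    have h1 : ∀ i j e, |drift J σ i j e| ≤ if i ∈ J then 4 / (J.card : ℝ) else 0 := by
      intro i j e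
      by_cases hi : i ∈ J
      · rw [if_pos hi]
        refine (abs_drift_le J σ i j e).trans ?_
        have := Real.sqrt_le_one.2 (sqDev_le_one hJ σ)
        gcongr
        linarith
      · simp [drift, hi]
    rw [← Finset.sum_neg_distrib]
    have h2 : ∑ i : Fin n, (if i ∈ J then 8 / (J.card : ℝ) else 0) = 8 := by
      simp only [Finset.sum_ite_mem, Finset.univ_inter, Finset.sum_const, nsmul_eq_mul]
      field_simp
    rw [← h2]
    refine Finset.sum_le_sum fun i _ => ?_
    have a := neg_le_of_abs_le (h1 i i true)
    have b := neg_le_of_abs_le (h1 i i false)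
    by_cases hi : i ∈ J
    · simp only [if_pos hi] at a b ⊢
      have : 8 / (J.card : ℝ) = 4 / J.card + 4 / J.card := by ring
      linarith
    · simp only [if_neg hi] at a b ⊢
      linarith
  have hfull : ∑ i, ∑ j, (drift J σ i j true + drift J σ i j false) ≤
      - (4 * n * ((1 - absDev σ) * sqDev J σ)) := by
    have h1 : ∀ i j, drift J σ i j true + drift J σ i j false =
        if i ∈ J then 2 / (J.card : ℝ) * (dev J σ (σ i * σ j) + dev J σ (σ i * (σ j)⁻¹)
          - 2 * dev J σ (σ i)) else 0 := by
      intro i j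
      by_cases hi : i ∈ J
      · simp [drift, hi]; ring
      · simp [drift, hi]
    rw [Finset.sum_comm]
    simp only [h1]
    have h2 : ∀ j, (∑ i, if i ∈ J then 2 / (J.card : ℝ) * (dev J σ (σ i * σ j)
        + dev J σ (σ i * (σ j)⁻¹) - 2 * dev J σ (σ i)) else 0) =
        2 * (corr J σ (σ j) + corr J σ (σ j)⁻¹ - 2 * sqDev J σ) := by
      intro j
      rw [Finset.sum_ite_mem, Finset.univ_inter, ← Finset.mul_sum, Finset.sum_sub_distrib,
        Finset.sum_add_distrib, sum_dev_mul_right hJ, sum_dev_mul_right hJ, ← Finset.mul_sum,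
        sum_dev_apply hJ]
      field_simp
    simp only [h2]
    rw [← Finset.mul_sum, Finset.sum_sub_distrib, Finset.sum_add_distrib]
    have h3 := sum_apply_le σ (corr J σ) (sum_corr hJ σ) (abs_corr_le J σ)
    have h4 := sum_apply_le σ (fun g => corr J σ g⁻¹)
      ((Equiv.sum_comp (Equiv.inv G) (corr J σ)).trans (sum_corr hJ σ))
      (fun g => abs_corr_le J σ g⁻¹)
    simp only [Finset.sum_const, Finset.card_univ, Fintype.card_fin, nsmul_eq_mul]
    linarith
  linarith

lemma height_sub_le (J : Finset (Fin n)) (σ τ : Config G n) :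
    height J τ - height J σ ≤ n * (sqDev J τ - sqDev J σ) / (2 * height J σ) := by
  have h1 := one_le_height J σ
  rw [le_div_iff₀ (by linarith)]
  nlinarith [height_sq J σ, height_sq J τ, sq_nonneg (height J τ - height J σ)]

lemma abs_height_sub_le (J : Finset (Fin n)) (σ τ : Config G n) :
    |height J τ - height J σ| ≤ n * |sqDev J τ - sqDev J σ| / height J σ := by
  have h1 := one_le_height J σ
  have h2 := one_le_height J τ
  rw [le_div_iff₀ (by linarith)]
  have h3 : (n : ℝ) * |sqDev J τ - sqDev J σ| =
      |height J τ - height J σ| * (height J τ + height J σ) := by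
    have h4 : |(n : ℝ)| = n := abs_of_nonneg (Nat.cast_nonneg n)
    have h5 : |height J τ + height J σ| = height J τ + height J σ :=
      abs_of_nonneg (by linarith)
    rw [← h5, ← abs_mul]
    nth_rewrite 1 [← h4]
    rw [← abs_mul]
    congr 1
    linear_combination height_sq J σ - height_sq J τ
  rw [h3]
  exact mul_le_mul_of_nonneg_left (by linarith) (abs_nonneg _)

lemma abs_height_applyMove_sub_le [NeZero n] {J : Finset (Fin n)} {q : ℝ} (hq : 1 ≤ q)
    (hJ : (n : ℝ) ≤ 2 * q * J.card) (σ : Config G n) (m : Move n) :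
    |height J (applyMove G σ m) - height J σ| ≤ 16 * q ^ 2 / Real.sqrt n := by
  have hn1 : (1 : ℝ) ≤ n := by exact_mod_cast Nat.one_le_iff_ne_zero.2 (NeZero.ne n)
  have hm : (0 : ℝ) < J.card := by
    by_contra h
    nlinarith
  set w := Real.sqrt n with hw
  have hw2 : w ^ 2 = n := Real.sq_sqrt (by linarith)
  have hw1 : 1 ≤ w := Real.one_le_sqrt.2 hn1
  have h1 := one_le_height J σ
  have hsq : |sqDev J (applyMove G σ m) - sqDev J σ| ≤
      4 * Real.sqrt (sqDev J σ) / J.card + 2 / (J.card : ℝ) ^ 2 := by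
    obtain ⟨ha, hb⟩ := sqDev_applyMove J σ m
    have hc := abs_le.1 (abs_drift_le J σ m.1.1.1 m.1.1.2 m.2)
    have hd : 0 ≤ 2 / (J.card : ℝ) ^ 2 := by positivity
    rw [abs_le]
    constructor <;> linarith [hc.1, hc.2]
  refine (abs_height_sub_le J σ _).trans ?_
  have hs := sqrt_mul_sqrt_le_height J σ
  rw [← hw] at hs
  rw [div_le_iff₀ (by linarith)]
  have hinv : 1 / (J.card : ℝ) ≤ 2 * q / w ^ 2 := by
    rw [div_le_div_iff₀ hm (by positivity)]
    linarith
  have hinv0 : 0 ≤ 1 / (J.card : ℝ) := by positivity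
  calc (n : ℝ) * |sqDev J (applyMove G σ m) - sqDev J σ|
      ≤ w ^ 2 * (4 * Real.sqrt (sqDev J σ) * (1 / J.card) + 2 * (1 / (J.card : ℝ)) ^ 2) := by
        rw [hw2]
        refine mul_le_mul_of_nonneg_left (hsq.trans (le_of_eq ?_)) (by linarith)
        ring
    _ ≤ w ^ 2 * (4 * Real.sqrt (sqDev J σ) * (2 * q / w ^ 2) + 2 * (2 * q / w ^ 2) ^ 2) := by
        gcongr
    _ = 8 * q / w * (w * Real.sqrt (sqDev J σ)) + 8 * q ^ 2 / w * (1 / w) := by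
        field_simp
        ring
    _ ≤ 8 * q ^ 2 / w * height J σ + 8 * q ^ 2 / w * height J σ := by
        gcongr
        · nlinarith
        · exact (div_le_one (by linarith)).2 hw1 |>.trans h1
    _ = 16 * q ^ 2 / w * height J σ := by ring

set_option maxHeartbeats 1000000 in
/-- One-step bound for the exponential moment of the height. -/
lemma avg_exp_height_le {J : Finset (Fin n)} {q θ : ℝ} (hq : 1 ≤ q)
    (hn2 : 2 ≤ n) (hn : 128 * q ^ 2 ≤ Real.sqrt n)
    (hJ : (n : ℝ) ≤ 2 * q * J.card) (hθ0 : 0 ≤ θ) (hθ : θ ≤ 8) (σ : Config G n)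
    (hs : absDev σ ≤ 1) :
    avg (fun τ => Real.exp (θ * height J τ)) σ ≤
      Real.exp (θ * height J σ * (1 - (1 - absDev σ) / n) + 2100 * q ^ 4 * θ / n) := by
  have : NeZero n := ⟨by omega⟩
  have hn2' : (2 : ℝ) ≤ n := by exact_mod_cast hn2
  have hn0 : (0 : ℝ) < n := by linarith
  have hm : (0 : ℝ) < J.card := by
    by_contra h
    nlinarith
  have hJne : J.Nonempty := Finset.card_pos.1 (by exact_mod_cast hm)
  set w := Real.sqrt n with hw
  have hw2 : w ^ 2 = n := Real.sq_sqrt hn0.le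
  have hw0 : 0 < w := Real.sqrt_pos.2 hn0
  set H := height J σ with hH
  have hH1 : 1 ≤ H := one_le_height J σ
  set M := (Fintype.card (Move n) : ℝ) with hM
  have hMeq : M = 2 * n * (n - 1) := card_move
  have hMpos : 0 < M := by rw [hMeq]; nlinarith
  set E := 2 / (J.card : ℝ) ^ 2
  have hpt : ∀ m : Move n, Real.exp (θ * height J (applyMove G σ m)) ≤
      Real.exp (θ * H) * (1 + θ * (n * (drift J σ m.1.1.1 m.1.1.2 m.2 + E) / (2 * H))
        + θ ^ 2 * (256 * q ^ 4 / n)) := by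
    intro m
    set X := height J (applyMove G σ m) - H with hX
    have hXabs : |X| ≤ 16 * q ^ 2 / w := abs_height_applyMove_sub_le hq hJ σ m
    have hX1 : X ≤ n * (drift J σ m.1.1.1 m.1.1.2 m.2 + E) / (2 * H) := by
      refine (height_sub_le J σ _).trans ?_
      gcongr
      linarith [(sqDev_applyMove J σ m).2]
    have hX2 : X ^ 2 ≤ 256 * q ^ 4 / n := by
      rw [← sq_abs, ← hw2]
      calc |X| ^ 2 ≤ (16 * q ^ 2 / w) ^ 2 := by gcongr
        _ = _ := by ring
    have hsmall : |θ * X| ≤ 1 := by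
      rw [abs_mul, abs_of_nonneg hθ0]
      calc θ * |X| ≤ 8 * (16 * q ^ 2 / w) := by gcongr
        _ = 128 * q ^ 2 / w := by ring
        _ ≤ 1 := (div_le_one hw0).2 hn
    have hexp := (abs_le.1 (Real.abs_exp_sub_one_sub_id_le hsmall)).2
    have heq : θ * height J (applyMove G σ m) = θ * H + θ * X := by rw [hX]; ring
    rw [heq, Real.exp_add]
    refine mul_le_mul_of_nonneg_left ?_ (Real.exp_pos _).le
    have := mul_le_mul_of_nonneg_left hX1 hθ0
    have := mul_le_mul_of_nonneg_left hX2 (sq_nonneg θ)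
    nlinarith
  set D := ∑ m : Move n, drift J σ m.1.1.1 m.1.1.2 m.2 with hD
  have hDle : D / M ≤ - (2 * ((1 - absDev σ) * sqDev J σ) / n) + 8 / (n : ℝ) ^ 2 := by
    have h1 := sum_drift_le hJne σ
    have hp : 0 ≤ (1 - absDev σ) * sqDev J σ := mul_nonneg (by linarith) (sqDev_nonneg J σ)
    rw [div_le_iff₀ hMpos, hMeq]
    refine h1.trans ?_
    have h2 : (- (2 * ((1 - absDev σ) * sqDev J σ) / n) + 8 / (n : ℝ) ^ 2) * (2 * n * (n - 1))
        = - (4 * n * ((1 - absDev σ) * sqDev J σ)) + 4 * ((1 - absDev σ) * sqDev J σ)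
          + 16 * ((n - 1) / n) := by
      field_simp
      ring
    have h3 : (1 : ℝ) / 2 ≤ (n - 1) / n := by
      rw [div_le_div_iff₀ (by norm_num) hn0]; linarith
    rw [h2]
    linarith
  have hE : E ≤ 8 * q ^ 2 / (n : ℝ) ^ 2 := by
    rw [div_le_div_iff₀ (by positivity) (by positivity)]
    nlinarith [pow_le_pow_left₀ hn0.le hJ 2]
  have hsum : avg (fun τ => Real.exp (θ * height J τ)) σ ≤
      Real.exp (θ * H) * (1 + θ * (n * (D / M + E) / (2 * H))
        + θ ^ 2 * (256 * q ^ 4 / n)) := by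
    unfold avg
    rw [div_le_iff₀ hMpos]
    refine (Finset.sum_le_sum fun m _ => hpt m).trans (le_of_eq ?_)
    rw [← Finset.mul_sum, mul_assoc]
    congr 1
    simp only [mul_add, add_mul, add_div, Finset.sum_add_distrib, Finset.sum_const, nsmul_eq_mul,
      Finset.card_univ, ← Finset.mul_sum, ← Finset.sum_div, ← hM, ← hD]
    field_simp
  refine hsum.trans ?_
  have hrhs : θ * H * (1 - (1 - absDev σ) / n) + 2100 * q ^ 4 * θ / n =
      θ * H + (- (θ * H * ((1 - absDev σ) / n)) + 2100 * q ^ 4 * θ / n) := by ring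
  rw [hrhs, Real.exp_add]
  refine mul_le_mul_of_nonneg_left ?_ (Real.exp_pos _).le
  rw [add_assoc, add_comm (1 : ℝ)]
  refine le_trans ?_ (Real.add_one_le_exp _)
  have hq2 : 1 ≤ q ^ 2 := one_le_pow₀ hq
  have hq4 : q ^ 2 ≤ q ^ 4 := pow_le_pow_right₀ hq (by norm_num)
  have hterm : n * (D / M + E) / (2 * H) ≤ - (H * ((1 - absDev σ) / n)) + 9 * q ^ 4 / n := by
    calc n * (D / M + E) / (2 * H)
        ≤ n * (- (2 * ((1 - absDev σ) * sqDev J σ) / n) + 8 / (n : ℝ) ^ 2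
            + 8 * q ^ 2 / (n : ℝ) ^ 2) / (2 * H) := by gcongr
      _ = - ((1 - absDev σ) * (n * sqDev J σ) / (H * n)) + (4 + 4 * q ^ 2) / (n * H) := by
          field_simp
          ring
      _ = - (H * ((1 - absDev σ) / n)) + ((1 - absDev σ) + (4 + 4 * q ^ 2)) / (n * H) := by
          have : n * sqDev J σ = H ^ 2 - 1 := by rw [hH, height_sq]; ring
          rw [this]
          field_simp
          ring
      _ ≤ _ := by
          gcongr
          · have : 0 ≤ absDev σ := Finset.sum_nonneg fun _ _ => abs_nonneg _
            nlinarith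
          · nlinarith
  have h5 : θ * (n * (D / M + E) / (2 * H)) ≤
      θ * (- (H * ((1 - absDev σ) / n)) + 9 * q ^ 4 / n) := mul_le_mul_of_nonneg_left hterm hθ0
  have h6 : θ ^ 2 * (256 * q ^ 4 / n) ≤ 8 * θ * (256 * q ^ 4 / n) := by
    gcongr
    nlinarith
  have h7 : θ * (9 * q ^ 4 / n) + 8 * θ * (256 * q ^ 4 / n) ≤ 2100 * q ^ 4 * θ / n := by
    have : θ * (9 * q ^ 4 / n) + 8 * θ * (256 * q ^ 4 / n) = 2057 * (q ^ 4 * θ / n) := by ring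
    have h8 : 0 ≤ q ^ 4 * θ / n := by positivity
    have h9 : 2100 * q ^ 4 * θ / n = 2100 * (q ^ 4 * θ / n) := by ring
    linarith
  nlinarith

lemma avg_mono {f g : Config G n → ℝ} (h : ∀ τ, f τ ≤ g τ) (σ : Config G n) :
    avg f σ ≤ avg g σ :=
  div_le_div_of_nonneg_right (Finset.sum_le_sum fun _ _ => h _) (Nat.cast_nonneg _)

lemma avg_add (f g : Config G n → ℝ) (σ : Config G n) :
    avg (fun τ => f τ + g τ) σ = avg f σ + avg g σ := by
  simp only [avg, Finset.sum_add_distrib, add_div]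

lemma avg_sum (f : G → Config G n → ℝ) (σ : Config G n) :
    avg (fun τ => ∑ a, f a τ) σ = ∑ a, avg (f a) σ := by
  simp only [avg]
  rw [Finset.sum_comm, Finset.sum_div]

lemma avg_le_one {f : Config G n → ℝ} (h : ∀ τ, f τ ≤ 1) (σ : Config G n) :
    avg f σ ≤ 1 := by
  refine div_le_one_of_le₀ ?_ (Nat.cast_nonneg _)
  refine (Finset.sum_le_sum fun m _ => h _).trans ?_
  simp

lemma avg_exp_affine_le {J : Finset (Fin n)} {q θ θ' c c' : ℝ} (hq : 1 ≤ q)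
    (hn2 : 2 ≤ n) (hn : 128 * q ^ 2 ≤ Real.sqrt n)
    (hJ : (n : ℝ) ≤ 2 * q * J.card) (hθ0 : 0 ≤ θ') (hθ : θ' ≤ 8) (σ : Config G n)
    (hs : absDev σ ≤ 1) (h1 : θ' * Real.exp (-((1 - absDev σ) / n)) ≤ θ)
    (h2 : c' + 2100 * q ^ 4 * θ' / n ≤ c) :
    avg (fun τ => Real.exp (θ' * height J τ + c')) σ ≤ Real.exp (θ * height J σ + c) := by
  have h3 : avg (fun τ => Real.exp (θ' * height J τ + c')) σ =
      avg (fun τ => Real.exp (θ' * height J τ)) σ * Real.exp c' := by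
    simp only [avg, Real.exp_add, ← Finset.sum_mul]
    ring
  rw [h3]
  refine (mul_le_mul_of_nonneg_right
    (avg_exp_height_le hq hn2 hn hJ hθ0 hθ σ hs) (Real.exp_pos _).le).trans ?_
  rw [← Real.exp_add]
  refine Real.exp_le_exp.2 ?_
  have h4 : θ' * (1 - (1 - absDev σ) / n) ≤ θ := by
    refine le_trans (mul_le_mul_of_nonneg_left ?_ hθ0) h1
    linarith [Real.add_one_le_exp (-((1 - absDev σ) / n))]
  have h5 := mul_le_mul_of_nonneg_right h4 (zero_le_one.trans (one_le_height J σ))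
  nlinarith

/-- The exponents used in the supermartingale that controls the overall deviation. -/
def coarseRate (n t : ℕ) : ℝ := Real.exp (t / (2 * n) - Real.log n / 4)

/-- The exponents used in the supermartingale that controls the deviation on a block. -/
def fineRate (n T t : ℕ) : ℝ :=
  Real.exp ((t - T) / n + 2 * Real.exp (-(t / (2 * n))))

lemma coarseRate_le (hn : 1 ≤ n) {T t : ℕ} (hT : (T : ℝ) ≤ 1 / 2 * n * Real.log n + 1)
    (ht : t ≤ T) : coarseRate n t ≤ 8 := by
  have hn' : (1 : ℝ) ≤ n := by exact_mod_cast hn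
  have ht' : (t : ℝ) ≤ T := by exact_mod_cast ht
  have h : (t : ℝ) / (2 * n) - Real.log n / 4 ≤ 1 := by
    rw [sub_le_iff_le_add, div_le_iff₀ (by linarith)]
    nlinarith
  exact (Real.exp_le_exp.2 h).trans (by linarith [Real.exp_one_lt_d9])

lemma exp_two_lt : Real.exp 2 < 8 := by
  have h : Real.exp 2 = Real.exp 1 ^ 2 := by rw [← Real.exp_nat_mul]; norm_num
  rw [h]
  nlinarith [Real.exp_one_lt_d9, Real.exp_pos 1]

lemma fineRate_le_mul (hn : 1 ≤ n) (T t : ℕ) :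
    fineRate n T (t + 1) ≤ 27 * Real.exp ((t - T) / n) := by
  have hn' : (1 : ℝ) ≤ n := by exact_mod_cast hn
  have h1 : Real.exp (-((t + 1 : ℕ) / (2 * n) : ℝ)) ≤ 1 := by
    rw [Real.exp_le_one_iff, neg_nonpos]; positivity
  have h2 : (1 : ℝ) / n ≤ 1 := by rw [div_le_one (by linarith)]; exact hn'
  have h3 : Real.exp 3 ≤ 27 := by
    have h : Real.exp 3 = Real.exp 1 ^ 3 := by rw [← Real.exp_nat_mul]; norm_num
    have h' : (27 : ℝ) = 3 ^ 3 := by norm_num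
    rw [h, h']
    gcongr
    exact Real.exp_one_lt_d9.le.trans (by norm_num)
  calc fineRate n T (t + 1) ≤ Real.exp (3 + (t - T) / n) := by
        refine Real.exp_le_exp.2 ?_
        have : (((t + 1 : ℕ) : ℝ) - T) / n = 1 / n + (t - T) / n := by push_cast; ring
        rw [this]
        linarith
    _ ≤ _ := by rw [Real.exp_add]; gcongr

lemma fineRate_le {T t : ℕ} (ht : t ≤ T) : fineRate n T t ≤ 8 := by
  refine le_trans (Real.exp_le_exp.2 ?_) exp_two_lt.le
  have h1 : Real.exp (-(t / (2 * n) : ℝ)) ≤ 1 := by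
    rw [Real.exp_le_one_iff, neg_nonpos]; positivity
  have ht' : (t : ℝ) ≤ T := by exact_mod_cast ht
  have h2 : ((t : ℝ) - T) / n ≤ 0 := div_nonpos_of_nonpos_of_nonneg (by linarith) (by positivity)
  linarith

lemma coarseRate_succ_mul_le (hn : 1 ≤ n) (t : ℕ) {s : ℝ} (hs : s ≤ 1 / 2) :
    coarseRate n (t + 1) * Real.exp (-((1 - s) / n)) ≤ coarseRate n t := by
  have hn' : (0 : ℝ) < n := by exact_mod_cast hn
  rw [coarseRate, coarseRate, ← Real.exp_add]
  refine Real.exp_le_exp.2 ?_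
  have h1 : ((t + 1 : ℕ) : ℝ) / (2 * n) = t / (2 * n) + 1 / 2 / n := by
    push_cast; field_simp
  have h2 : 1 / 2 / (n : ℝ) ≤ (1 - s) / n := by gcongr; linarith
  linarith

lemma fineRate_succ_mul_le (hn : 1 ≤ n) (T t : ℕ) {s : ℝ}
    (hs : s ≤ 1 / 2 * Real.exp (-(t / (2 * n)))) :
    fineRate n T (t + 1) * Real.exp (-((1 - s) / n)) ≤ fineRate n T t := by
  have hn' : (1 : ℝ) ≤ n := by exact_mod_cast hn
  have hn0 : (0 : ℝ) < n := by linarith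
  rw [fineRate, fineRate, ← Real.exp_add]
  refine Real.exp_le_exp.2 ?_
  set u := Real.exp (-(t / (2 * n) : ℝ)) with hu
  have hu0 : 0 < u := Real.exp_pos _
  have h1 : Real.exp (-((t + 1 : ℕ) / (2 * n) : ℝ)) = u * Real.exp (-(1 / (2 * n))) := by
    rw [hu, ← Real.exp_add]; congr 1; push_cast; ring
  have h2 : Real.exp (-(1 / (2 * n) : ℝ)) ≤ 1 - 1 / (4 * n) := by
    rw [Real.exp_neg]
    have h3 := Real.add_one_le_exp (1 / (2 * n) : ℝ)
    refine (inv_anti₀ (by positivity) h3).trans ?_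
    rw [inv_le_iff_one_le_mul₀ (by positivity)]
    have h4 : (1 - 1 / (4 * n) : ℝ) * (1 / (2 * n) + 1) = 1 + (2 * n - 1) / (8 * n ^ 2) := by
      field_simp
      ring
    rw [h4]
    have : 0 ≤ (2 * n - 1 : ℝ) / (8 * n ^ 2) := div_nonneg (by linarith) (by positivity)
    linarith
  have h5 : (((t + 1 : ℕ) : ℝ) - T) / n + -((1 - s) / n) = (t - T) / n + s / n := by
    push_cast; ring
  have h6 : s / n ≤ 2 * (u * (1 / (4 * n))) := by
    have : 2 * (u * (1 / (4 * n))) = 1 / 2 * u / (n : ℝ) := by field_simp; norm_num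
    rw [this]
    gcongr
  rw [h1]
  have h7 := mul_le_mul_of_nonneg_left h2 hu0.le
  nlinarith

lemma absDev_le_of_coarseRate_mul_height_lt (hn : 1 ≤ n) (t : ℕ) {σ : Config G n}
    (h : coarseRate n t * height Finset.univ σ <
      Real.exp (Real.log n / 4) / (2 * Real.sqrt (Fintype.card G))) :
    absDev σ ≤ 1 / 2 * Real.exp (-(t / (2 * n))) := by
  have hn0 : (0 : ℝ) < n := by exact_mod_cast hn
  refine (absDev_le σ).trans ?_
  set p := Real.sqrt (Fintype.card G)
  have hp : 0 < p := Real.sqrt_pos.2 card_group_pos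
  set v := Real.sqrt (sqDev Finset.univ σ)
  have hw : Real.sqrt n = Real.exp (Real.log n / 2) := by
    rw [Real.exp_half, Real.exp_log hn0]
  have h1 := (mul_le_mul_of_nonneg_left (sqrt_mul_sqrt_le_height Finset.univ σ)
    (Real.exp_pos (t / (2 * n) - Real.log n / 4)).le).trans_lt h
  rw [hw, ← mul_assoc, ← Real.exp_add, lt_div_iff₀ (by positivity)] at h1
  have h2 : (t / (2 * n) - Real.log n / 4 + Real.log n / 2 : ℝ) =
    t / (2 * n) + Real.log n / 4 := by ring
  rw [h2, Real.exp_add] at h1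
  rw [Real.exp_neg, ← div_eq_mul_inv, le_div_iff₀ (Real.exp_pos _)]
  have h3 := Real.exp_pos (Real.log n / 4)
  refine le_of_mul_le_mul_right ?_ h3
  nlinarith

/-- The supermartingale that dominates the probability of a large deviation. -/
def lyapunov (J : G → Finset (Fin n)) (K R : ℝ) (T t : ℕ) (τ : Config G n) : ℝ :=
  min 1 (Real.exp (coarseRate n t * height Finset.univ τ +
      (8 * K * (T - t) / n -
        Real.exp (Real.log n / 4) / (2 * Real.sqrt (Fintype.card G)))) +
    ∑ a, Real.exp (fineRate n T t * height (J a) τ +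
      (27 * K * (1 - Real.exp ((t - T) / n)) - R)))

lemma avg_lyapunov_le {J : G → Finset (Fin n)} {q : ℝ} (hq : 1 ≤ q)
    (hn2 : 2 ≤ n) (hn : 128 * q ^ 2 ≤ Real.sqrt n)
    (hJ : ∀ a, (n : ℝ) ≤ 2 * q * (J a).card) {T t : ℕ}
    (hT : (T : ℝ) ≤ 1 / 2 * n * Real.log n + 1) (ht : t < T) (R : ℝ) (σ : Config G n) :
    avg (lyapunov J (2100 * q ^ 4) R T (t + 1)) σ ≤ lyapunov J (2100 * q ^ 4) R T t σ := by
  have hn1 : 1 ≤ n := by omega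
  have hn0 : (0 : ℝ) < n := by exact_mod_cast hn1
  have hle1 : avg (lyapunov J (2100 * q ^ 4) R T (t + 1)) σ ≤ 1 :=
    avg_le_one (fun τ => min_le_left _ _) σ
  have hK : 0 ≤ 2100 * q ^ 4 := by positivity
  refine le_min hle1 ?_
  by_cases hbad : Real.exp (Real.log n / 4) / (2 * Real.sqrt (Fintype.card G)) ≤
      coarseRate n t * height Finset.univ σ
  · refine hle1.trans ?_
    have h1 : 0 ≤ 8 * (2100 * q ^ 4) * ((T : ℝ) - t) / n := by
      have : (t : ℝ) ≤ T := by exact_mod_cast ht.le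
      have : 0 ≤ (T : ℝ) - t := by linarith
      positivity
    have h2 : 1 ≤ Real.exp (coarseRate n t * height Finset.univ σ +
        (8 * (2100 * q ^ 4) * (T - t) / n -
          Real.exp (Real.log n / 4) / (2 * Real.sqrt (Fintype.card G)))) :=
      Real.one_le_exp (by linarith)
    have h3 : 0 ≤ ∑ a, Real.exp (fineRate n T t * height (J a) σ +
      (27 * (2100 * q ^ 4) * (1 - Real.exp ((t - T) / n)) - R)) :=
      Finset.sum_nonneg fun _ _ => (Real.exp_pos _).le
    linarith
  · have hs := absDev_le_of_coarseRate_mul_height_lt hn1 t (not_le.1 hbad)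
    have hexp : Real.exp (-(t / (2 * n) : ℝ)) ≤ 1 := by
      rw [Real.exp_le_one_iff, neg_nonpos]; positivity
    have hs2 : absDev σ ≤ 1 / 2 := by linarith
    refine (avg_mono (fun τ => min_le_right _ _) σ).trans ?_
    rw [avg_add, avg_sum]
    refine add_le_add ?_ (Finset.sum_le_sum fun a _ => ?_)
    · have hr := coarseRate_le hn1 hT (show t + 1 ≤ T from ht)
      refine avg_exp_affine_le (θ := coarseRate n t) (θ' := coarseRate n (t + 1)) hq hn2 hn ?_
        (Real.exp_pos _).le hr σ (by linarith)
        (coarseRate_succ_mul_le hn1 t hs2) ?_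
      · rw [Finset.card_univ, Fintype.card_fin]; nlinarith
      · have h1 : 2100 * q ^ 4 * coarseRate n (t + 1) / n ≤ 2100 * q ^ 4 * 8 / n := by gcongr
        have h2 : 8 * (2100 * q ^ 4) * ((T : ℝ) - t) / n =
            8 * (2100 * q ^ 4) * (T - (t + 1 : ℕ)) / n + 2100 * q ^ 4 * 8 / n := by
          push_cast; ring
        linarith
    · refine avg_exp_affine_le (θ := fineRate n T t) (θ' := fineRate n T (t + 1)) hq hn2 hn
        (hJ a) (Real.exp_pos _).le
        (fineRate_le (show t + 1 ≤ T from ht)) σ (by linarith)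
        (fineRate_succ_mul_le hn1 T t hs) ?_
      have h1 : 2100 * q ^ 4 * fineRate n T (t + 1) / n ≤
          2100 * q ^ 4 * (27 * Real.exp ((t - T) / n)) / n := by
        gcongr
        exact fineRate_le_mul hn1 T t
      have h2 : Real.exp ((((t + 1 : ℕ) : ℝ) - T) / n) =
          Real.exp ((t - T) / n) * Real.exp (1 / n) := by
        rw [← Real.exp_add]; congr 1; push_cast; ring
      have h3 := mul_le_mul_of_nonneg_left (Real.add_one_le_exp (1 / n : ℝ))
        (Real.exp_pos ((t - T) / n : ℝ)).le
      have h4 := mul_le_mul_of_nonneg_left h3 hK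
      rw [h2]
      have h5 : 2100 * q ^ 4 * (27 * Real.exp ((t - T) / n)) / n =
        27 * (2100 * q ^ 4 * (Real.exp ((t - T) / n) * (1 / n))) := by ring
      linarith

lemma lyapunov_zero_le {J : G → Finset (Fin n)} (hJ : ∀ a, (J a).Nonempty) {K : ℝ}
    (hK : 0 ≤ K) (hn : 1 ≤ n) {T : ℕ} (hT1 : 1 / 2 * n * Real.log n ≤ T)
    (hT2 : (T : ℝ) ≤ 1 / 2 * n * Real.log n + 1)
    (hbig : 1 + 8 * K * (Real.log n / 2 + 1) + Real.log n ≤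
      Real.exp (Real.log n / 4) / (4 * Fintype.card G))
    (R : ℝ) {σ : Config G n}
    (hσ : Real.sqrt (sqDev Finset.univ σ) ≤ 1 / (4 * Fintype.card G)) :
    lyapunov J K R T 0 σ ≤
      1 / n + Fintype.card G * Real.exp (16 + 27 * K) * Real.exp (-R) := by
  have hn1 : (1 : ℝ) ≤ n := by exact_mod_cast hn
  have hn0 : (0 : ℝ) < n := by linarith
  have hw : Real.sqrt n = Real.exp (Real.log n / 2) := by
    rw [Real.exp_half, Real.exp_log hn0]
  have hQ := card_group_pos (G := G)
  have hQ1 : (1 : ℝ) ≤ Fintype.card G := by exact_mod_cast Fintype.card_pos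
  have hL : 0 ≤ Real.log n := Real.log_nonneg hn1
  refine (min_le_right _ _).trans (add_le_add ?_ ?_)
  · have h1 : (1 : ℝ) / n = Real.exp (-Real.log n) := by
      rw [Real.exp_neg, Real.exp_log hn0, one_div]
    rw [h1]
    refine Real.exp_le_exp.2 ?_
    have h2 : coarseRate n 0 * height Finset.univ σ ≤
        1 + Real.exp (Real.log n / 4) / (4 * Fintype.card G) := by
      calc coarseRate n 0 * height Finset.univ σ
          ≤ coarseRate n 0 * (1 + Real.sqrt n * (1 / (4 * Fintype.card G))) := by
            refine mul_le_mul_of_nonneg_left ?_ (Real.exp_pos _).le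
            refine (height_le _ _).trans ?_
            gcongr
        _ = Real.exp (-(Real.log n / 4)) +
            Real.exp (Real.log n / 4) / (4 * Fintype.card G) := by
            have h3 : Real.exp (Real.log n / 4) =
                Real.exp (-(Real.log n / 4)) * Real.exp (Real.log n / 2) := by
              rw [← Real.exp_add]; congr 1; ring
            rw [h3, hw, coarseRate]
            simp only [Nat.cast_zero, zero_div, zero_sub]
            ring
        _ ≤ _ := by
            gcongr
            rw [Real.exp_le_one_iff]
            linarith
    have h4 : Real.exp (Real.log n / 4) / (2 * Fintype.card G) ≤
        Real.exp (Real.log n / 4) / (2 * Real.sqrt (Fintype.card G)) := by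
      have : Real.sqrt (Fintype.card G) ≤ Fintype.card G :=
        Real.sqrt_le_iff.2 ⟨hQ.le, by nlinarith⟩
      have := Real.sqrt_pos.2 hQ
      gcongr
    have h5 : Real.exp (Real.log n / 4) / (2 * Fintype.card G) =
        2 * (Real.exp (Real.log n / 4) / (4 * Fintype.card G)) := by
      field_simp; norm_num
    have h6 : 8 * K * (T - (0 : ℕ)) / n ≤ 8 * K * (Real.log n / 2 + 1) := by
      rw [mul_div_assoc]
      refine mul_le_mul_of_nonneg_left ?_ (by positivity)
      rw [div_le_iff₀ hn0]
      push_cast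
      nlinarith
    linarith
  · have h1 : ∀ a, Real.exp (fineRate n T 0 * height (J a) σ +
        (27 * K * (1 - Real.exp (((0 : ℕ) - T) / n)) - R)) ≤
        Real.exp (16 + 27 * K) * Real.exp (-R) := by
      intro a
      rw [← Real.exp_add]
      refine Real.exp_le_exp.2 ?_
      have h2 : fineRate n T 0 ≤ Real.exp 2 * Real.exp (-(Real.log n / 2)) := by
        rw [fineRate, ← Real.exp_add]
        refine Real.exp_le_exp.2 ?_
        have : Real.log n / 2 ≤ T / n := by
          rw [le_div_iff₀ hn0]; linarith
        simp only [Nat.cast_zero, zero_div, zero_sub, neg_zero, Real.exp_zero, neg_div]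
        linarith
      have h3 : height (J a) σ ≤ 2 * Real.exp (Real.log n / 2) := by
        refine (height_le _ _).trans ?_
        have h4 := Real.sqrt_le_one.2 (sqDev_le_one (hJ a) σ)
        have h5 : 1 ≤ Real.exp (Real.log n / 2) := Real.one_le_exp (by linarith)
        rw [hw]
        nlinarith
      have h4 : fineRate n T 0 * height (J a) σ ≤ 16 := by
        calc fineRate n T 0 * height (J a) σ
            ≤ (Real.exp 2 * Real.exp (-(Real.log n / 2))) * (2 * Real.exp (Real.log n / 2)) :=
              mul_le_mul h2 h3 (zero_le_one.trans (one_le_height _ _)) (by positivity)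
          _ = 2 * Real.exp 2 * (Real.exp (-(Real.log n / 2)) * Real.exp (Real.log n / 2)) := by
              ring
          _ = 2 * Real.exp 2 := by rw [← Real.exp_add]; simp
          _ ≤ 16 := by linarith [exp_two_lt]
      have h5 : 27 * K * (1 - Real.exp (((0 : ℕ) - T) / n)) ≤ 27 * K * 1 := by
        gcongr
        linarith [Real.exp_pos ((((0 : ℕ) : ℝ) - T) / n)]
      linarith
    refine (Finset.sum_le_sum fun a _ => h1 a).trans (le_of_eq ?_)
    rw [Finset.sum_const, Finset.card_univ, nsmul_eq_mul, mul_assoc]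

lemma one_le_lyapunov_self {J : G → Finset (Fin n)} {K R : ℝ} (hn : 1 ≤ n) (T : ℕ)
    {τ : Config G n} {a : G} (hτ : R / Real.sqrt n < Real.sqrt (sqDev (J a) τ)) :
    1 ≤ lyapunov J K R T T τ := by
  refine le_min le_rfl ?_
  have hw : 0 < Real.sqrt n := Real.sqrt_pos.2 (by exact_mod_cast hn)
  have h1 : R ≤ height (J a) τ := by
    rw [div_lt_iff₀ hw] at hτ
    linarith [sqrt_mul_sqrt_le_height (J a) τ]
  have h2 : 1 ≤ fineRate n T T := Real.one_le_exp (by simp; positivity)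
  have h3 := one_le_height (J a) τ
  have h4 : 1 ≤ Real.exp (fineRate n T T * height (J a) τ +
      (27 * K * (1 - Real.exp ((T - T) / n)) - R)) := by
    refine Real.one_le_exp ?_
    simp only [sub_self, zero_div, Real.exp_zero, mul_zero, zero_sub]
    nlinarith
  have h5 := Finset.single_le_sum (f := fun a => Real.exp (fineRate n T T * height (J a) τ +
      (27 * K * (1 - Real.exp ((T - T) / n)) - R)))
    (fun _ _ => (Real.exp_pos _).le) (Finset.mem_univ a)
  have h6 := Real.exp_pos (coarseRate n T * height Finset.univ τ +
      (8 * K * (T - T) / n -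
        Real.exp (Real.log n / 4) / (2 * Real.sqrt (Fintype.card G))))
  beta_reduce at h5
  linarith

lemma prob_le_sum_law_mul {σ₀ : Config G n} (h₀ : σ₀ ∈ gens G n) (T : ℕ)
    {E : Set (Config G n)} {f : Config G n → ℝ} (hf0 : ∀ τ, 0 ≤ f τ)
    (hf : ∀ τ ∈ E, τ ∈ gens G n → 1 ≤ f τ) :
    prob G σ₀ T E ≤ ∑ τ, law G σ₀ T τ * f τ := by
  rw [prob, Finset.sum_filter]
  refine Finset.sum_le_sum fun τ _ => ?_
  have hl := law_nonneg σ₀ T τ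
  split_ifs with hE
  · by_cases hg : τ ∈ gens G n
    · nlinarith [hf τ hE hg]
    · simp [law_eq_zero_of_notMem_gens h₀ T hg]
  · exact mul_nonneg hl (hf0 τ)

lemma lyapunov_nonneg (J : G → Finset (Fin n)) (K R : ℝ) (T t : ℕ) (τ : Config G n) :
    0 ≤ lyapunov J K R T t τ :=
  le_min zero_le_one (add_nonneg (Real.exp_pos _).le
    (Finset.sum_nonneg fun _ _ => (Real.exp_pos _).le))

lemma sqrt_sqDev_univ_le {δ : ℝ} {σ : Config G n} (hσ : σ ∈ SAst G n δ) :
    Real.sqrt (sqDev Finset.univ σ) ≤ δ := by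
  simpa [sqDev, dev, nCount] using hσ.2

lemma le_mul_nCount {σ : Config G n}
    (hσ : σ ∈ SAst G n (1 / (4 * (Fintype.card G : ℝ)))) (hn : 1 ≤ n) (a : G) :
    (n : ℝ) ≤ 2 * Fintype.card G * (Finset.univ.filter (fun i => σ i = a)).card := by
  have hn0 : (0 : ℝ) < n := by exact_mod_cast hn
  have hQ := card_group_pos (G := G)
  have h := (abs_le.1 ((abs_dev_le Finset.univ σ a).trans (sqrt_sqDev_univ_le hσ))).1
  simp only [dev, Finset.card_univ, Fintype.card_fin] at h
  have h1 : 3 / (4 * Fintype.card G) ≤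
      ((Finset.univ.filter (fun i => σ i = a)).card : ℝ) / n := by
    have : (3 : ℝ) / (4 * Fintype.card G) =
      1 / Fintype.card G - 1 / (4 * Fintype.card G) := by field_simp; norm_num
    linarith
  rw [div_le_div_iff₀ (by positivity) hn0] at h1
  linarith

lemma eventually_log_le (A B : ℝ) {c : ℝ} (hc : 0 < c) :
    ∀ᶠ n : ℕ in atTop, A + B * Real.log n ≤ Real.exp (Real.log n / 4) * c := by
  have hlog : Tendsto (fun n : ℕ => Real.log n) atTop atTop :=
    Real.tendsto_log_atTop.comp tendsto_natCast_atTop_atTop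
  have h : ∀ᶠ x : ℝ in atTop, A + B * x ≤ Real.exp (x / 4) * c := by
    have h1 : (fun x : ℝ => A + B * x) =o[atTop] fun x => Real.exp (1 / 4 * x) := by
      have h2 := isLittleO_pow_exp_pos_mul_atTop 0 (show (0 : ℝ) < 1 / 4 by norm_num)
      have h3 := isLittleO_pow_exp_pos_mul_atTop 1 (show (0 : ℝ) < 1 / 4 by norm_num)
      simpa using (h2.const_mul_left A).add (h3.const_mul_left B)
    filter_upwards [h1.bound hc] with x hx
    rw [Real.norm_eq_abs, Real.norm_eq_abs, abs_of_pos (Real.exp_pos _)] at hx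
    have : x / 4 = 1 / 4 * x := by ring
    rw [this]
    linarith [(le_abs_self (A + B * x)).trans hx]
  exact hlog.eventually h

end Averaging

end PR

/-- Lemma 2.4: with `T = ⌈(1/2) n log n⌉`, there is a constant `C_G > 0`
depending only on `G` such that for any `R > 0` and all large enough `n`, for any
`σ_*, σ'_* ∈ S_*(1/(4Q))`, `Pr_{σ'_*}(σ_T ∉ S_*(σ_*, R/√n)) ≤ C_G e^{−R} + 1/n`. -/
theorem matrix_averaging
    (G : Type) [Group G] [Fintype G] :
    ∃ C : ℝ, 0 < C ∧ ∀ R : ℝ, 0 < R →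
      ∃ N : ℕ, ∀ n : ℕ, N ≤ n →
        ∀ σast ∈ PR.SAst G n (1 / (4 * (Fintype.card G : ℝ))),
        ∀ σast' ∈ PR.SAst G n (1 / (4 * (Fintype.card G : ℝ))),
          PR.prob G σast' ⌈(1 / 2 : ℝ) * n * Real.log n⌉₊
            {τ | τ ∉ PR.SAstM G σast (R / Real.sqrt n)}
          ≤ C * Real.exp (-R) + 1 / n := by
  have hQ := PR.card_group_pos (G := G)
  have hQ1 : (1 : ℝ) ≤ Fintype.card G := by exact_mod_cast Fintype.card_pos
  set q : ℝ := (Fintype.card G : ℝ) with hq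
  set K : ℝ := 2100 * q ^ 4 with hK
  have hK0 : 0 ≤ K := by positivity
  refine ⟨q * Real.exp (16 + 27 * K), by positivity, fun R _ => ?_⟩
  have hsqrt : Tendsto (fun n : ℕ => Real.sqrt n) atTop atTop :=
    Real.tendsto_sqrt_atTop.comp tendsto_natCast_atTop_atTop
  obtain ⟨N, hN⟩ := eventually_atTop.1 (((eventually_ge_atTop 2).and
    (hsqrt.eventually_ge_atTop (128 * q ^ 2))).and
      (PR.eventually_log_le (1 + 8 * K) (4 * K + 1) (c := 1 / (4 * q)) (by positivity)))
  refine ⟨N, fun n hn σ hσ σ' hσ' => ?_⟩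
  obtain ⟨⟨hn2, hns⟩, hbig⟩ := hN n hn
  have hn1 : 1 ≤ n := by omega
  have hn1' : (1 : ℝ) ≤ n := by exact_mod_cast hn1
  set T := ⌈(1 / 2 : ℝ) * n * Real.log n⌉₊ with hT
  have hL : 0 ≤ Real.log n := Real.log_nonneg hn1'
  have hT1 : 1 / 2 * n * Real.log n ≤ T := Nat.le_ceil _
  have hT2 : (T : ℝ) ≤ 1 / 2 * n * Real.log n + 1 := (Nat.ceil_lt_add_one (by positivity)).le
  set J : G → Finset (Fin n) := fun a => Finset.univ.filter (fun i => σ i = a) with hJdef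
  have hJ : ∀ a, (n : ℝ) ≤ 2 * q * (J a).card := PR.le_mul_nCount hσ hn1
  have hJne : ∀ a, (J a).Nonempty := fun a => by
    rw [← Finset.card_pos]
    by_contra h
    have h0 : (J a).card = 0 := by omega
    have := hJ a
    rw [h0] at this
    norm_num at this
    linarith
  have hend : ∀ τ ∈ {τ | τ ∉ PR.SAstM G σ (R / Real.sqrt n)}, τ ∈ PR.gens G n →
      1 ≤ PR.lyapunov J K R T T τ := by
    intro τ hτ hg
    have h1 : ¬ ∀ a, Real.sqrt (PR.sqDev (J a) τ) ≤ R / Real.sqrt n := by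
      intro h
      refine hτ ⟨hg, fun a => ?_⟩
      have := h a
      simpa only [PR.sqDev, PR.dev, hJdef, Finset.filter_filter, PR.nab, PR.nCount] using this
    push Not at h1
    obtain ⟨a, ha⟩ := h1
    exact PR.one_le_lyapunov_self hn1 T ha
  calc PR.prob G σ' T {τ | τ ∉ PR.SAstM G σ (R / Real.sqrt n)}
      ≤ ∑ τ, PR.law G σ' T τ * PR.lyapunov J K R T T τ :=
        PR.prob_le_sum_law_mul hσ'.1 T (PR.lyapunov_nonneg J K R T T) hend
    _ ≤ PR.lyapunov J K R T 0 σ' :=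
        PR.sum_law_mul_le σ' T (PR.lyapunov J K R T)
          fun t ht τ => PR.avg_lyapunov_le hQ1 hn2 hns hJ hT2 ht R τ
    _ ≤ 1 / n + q * Real.exp (16 + 27 * K) * Real.exp (-R) := by
        refine PR.lyapunov_zero_le hJne hK0 hn1 hT1 hT2 ?_ R (PR.sqrt_sqDev_univ_le hσ')
        rw [div_eq_mul_one_div (Real.exp _), ← hq]
        linarith
    _ = _ := add_comm _ _
end
end

section
/- There exist constants C_G and m depending only on the finite group G such that for every δ < 1/(2Q), every R > 0, and all n > m, max_{σ_* ∈ S_*(δ)} π({σ ∈ S : σ ∉ S_*(σ_*, R/√n)}) ≤ 2·C_G·Q/R², where π is the uniform stationary distribution on S. -/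
open scoped BigOperators
open Filter

attribute [local instance] Classical.propDecidable

noncomputable section

namespace PR

section Helpers

variable (G : Type) [Group G] [Fintype G]

/-- Centred functions of two distinct coordinates are orthogonal. -/
lemma sum_config_mul_eq_zero {n : ℕ} (f g : G → ℝ) (hf : ∑ x, f x = 0)
    {i j : Fin n} (hij : i ≠ j) : ∑ τ : Config G n, f (τ i) * g (τ j) = 0 := by
  have hshift (y : G) : ∑ τ : Config G n, f (τ i) * g (τ j)
      = ∑ τ : Config G n, f (τ i * y) * g (τ j) := by
    rw [← Equiv.sum_comp (Equiv.mulRight (Pi.mulSingle i y : Config G n))]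
    refine Finset.sum_congr rfl fun τ _ => ?_
    simp [Pi.mulSingle_eq_of_ne hij.symm]
  have hcard : (Fintype.card G : ℝ) * ∑ τ : Config G n, f (τ i) * g (τ j) = 0 := by
    calc (Fintype.card G : ℝ) * ∑ τ : Config G n, f (τ i) * g (τ j)
        = ∑ _y : G, ∑ τ : Config G n, f (τ i) * g (τ j) := by simp
      _ = ∑ y : G, ∑ τ : Config G n, f (τ i * y) * g (τ j) :=
          Finset.sum_congr rfl fun y _ => hshift y
      _ = ∑ τ : Config G n, (∑ y : G, f (τ i * y)) * g (τ j) := by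
          rw [Finset.sum_comm]
          simp_rw [Finset.sum_mul]
      _ = 0 := by
          refine Finset.sum_eq_zero fun τ _ => ?_
          have h : ∑ y : G, f (τ i * y) = 0 := by
            rw [← hf]
            exact Equiv.sum_comp (Equiv.mulLeft (τ i)) f
          rw [h, zero_mul]
  exact (mul_eq_zero.mp hcard).resolve_left (by positivity)

lemma sum_config_sq_le {n : ℕ} (f : G → ℝ) (hf : ∑ x, f x = 0) (hf1 : ∀ x, f x ^ 2 ≤ 1)
    (A : Finset (Fin n)) :
    ∑ τ : Config G n, (∑ i ∈ A, f (τ i)) ^ 2 ≤ A.card * (Fintype.card G : ℝ) ^ n := by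
  calc ∑ τ : Config G n, (∑ i ∈ A, f (τ i)) ^ 2
      = ∑ i ∈ A, ∑ j ∈ A, ∑ τ : Config G n, f (τ i) * f (τ j) := by
        simp_rw [sq, Finset.sum_mul_sum]
        rw [Finset.sum_comm]
        exact Finset.sum_congr rfl fun i _ => Finset.sum_comm
    _ = ∑ i ∈ A, ∑ τ : Config G n, f (τ i) * f (τ i) := by
        refine Finset.sum_congr rfl fun i hi => ?_
        exact Finset.sum_eq_single_of_mem i hi fun j _ hj =>
          sum_config_mul_eq_zero G f f hf hj.symm
    _ ≤ ∑ i ∈ A, ∑ _τ : Config G n, (1 : ℝ) := by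
        gcongr with i _ τ _
        rw [← sq]
        exact hf1 _
    _ = A.card * (Fintype.card G : ℝ) ^ n := by simp

/-- A positive proportion, independent of `n`, of all `n`-tuples generate `G`. -/
lemma card_config_le_card_gens_mul {n : ℕ} (hn : Fintype.card G ≤ n) :
    Fintype.card G ^ n ≤
      (Finset.univ.filter (fun τ : Config G n => τ ∈ gens G n)).card *
        Fintype.card G ^ Fintype.card G := by
  obtain ⟨e⟩ : Nonempty (G ↪ Fin n) :=
    Function.Embedding.nonempty_of_card_le (by simpa using hn)
  have hmem (σ : Config G n) : Function.extend e id σ ∈ gens G n := by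
    have h : Set.range (Function.extend e id σ) = Set.univ :=
      Set.eq_univ_of_forall fun x => ⟨e x, e.injective.extend_apply _ _ _⟩
    simp [gens, h]
  have hle := Finset.card_le_card_of_injOn (s := (Finset.univ : Finset (Config G n)))
    (t := (Finset.univ.filter (fun τ : Config G n => τ ∈ gens G n)) ×ˢ
      (Finset.univ : Finset (G → G)))
    (fun σ => (Function.extend e id σ, σ ∘ e)) (fun σ _ => by simp [hmem σ]) (by
      intro σ _ τ _ h
      obtain ⟨h1, h2⟩ := Prod.mk.inj h
      funext k
      by_cases hk : ∃ x, e x = k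
      · obtain ⟨x, rfl⟩ := hk
        exact congrFun h2 x
      · have := congrFun h1 k
        rwa [Function.extend_apply' _ _ _ hk, Function.extend_apply' _ _ _ hk] at this)
  simpa [Finset.card_product] using hle

/-- The squared distance between row `a` of the empirical transition matrix and the uniform law. -/
def rowDev {n : ℕ} (σ₀ τ : Config G n) (a : G) : ℝ :=
  ∑ b : G, ((nab G σ₀ τ a b : ℝ) / (nCount G σ₀ a : ℝ) - 1 / (Fintype.card G : ℝ)) ^ 2

lemma sum_rowDev_le {n : ℕ} (σ₀ : Config G n) (a : G) (ha : 0 < nCount G σ₀ a) :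
    ∑ τ : Config G n, rowDev G σ₀ τ a ≤
      (Fintype.card G : ℝ) * (Fintype.card G : ℝ) ^ n / nCount G σ₀ a := by
  have hN : (0 : ℝ) < nCount G σ₀ a := by exact_mod_cast ha
  have hQ : (1 : ℝ) ≤ Fintype.card G := by exact_mod_cast Fintype.card_pos
  set f : G → G → ℝ := fun b x => (if x = b then 1 else 0) - 1 / (Fintype.card G : ℝ) with hf
  have hf0 (b : G) : ∑ x, f b x = 0 := by
    simp only [hf, Finset.sum_sub_distrib]
    simp
  have hf1 (b x : G) : f b x ^ 2 ≤ 1 := by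
    have h0 : 0 ≤ 1 / (Fintype.card G : ℝ) := by positivity
    have h1 : 1 / (Fintype.card G : ℝ) ≤ 1 := by
      rw [div_le_one (by positivity)]
      exact hQ
    rw [sq_le_one_iff_abs_le_one, abs_le]
    simp only [hf]
    split_ifs <;> constructor <;> linarith
  have hsum (τ : Config G n) (b : G) :
      (nab G σ₀ τ a b : ℝ) / (nCount G σ₀ a : ℝ) - 1 / (Fintype.card G : ℝ)
        = (∑ i ∈ Finset.univ.filter (fun i => σ₀ i = a), f b (τ i)) / nCount G σ₀ a := by
    have h : ∑ i ∈ Finset.univ.filter (fun i => σ₀ i = a), f b (τ i)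
        = nab G σ₀ τ a b - nCount G σ₀ a * (1 / (Fintype.card G : ℝ)) := by
      simp only [hf, Finset.sum_sub_distrib, Finset.sum_boole, Finset.filter_filter,
        Finset.sum_const, nsmul_eq_mul, nab, nCount]
    rw [h]
    field_simp
  calc ∑ τ : Config G n, rowDev G σ₀ τ a
      = ∑ b : G, (∑ τ : Config G n,
          (∑ i ∈ Finset.univ.filter (fun i => σ₀ i = a), f b (τ i)) ^ 2) /
            (nCount G σ₀ a : ℝ) ^ 2 := by
        simp_rw [rowDev, hsum, div_pow, Finset.sum_div]
        rw [Finset.sum_comm]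
    _ ≤ ∑ _b : G, (nCount G σ₀ a * (Fintype.card G : ℝ) ^ n) / (nCount G σ₀ a : ℝ) ^ 2 := by
        gcongr with b _
        exact sum_config_sq_le G (f b) (hf0 b) (hf1 b) _
    _ = (Fintype.card G : ℝ) * (Fintype.card G : ℝ) ^ n / nCount G σ₀ a := by
        rw [Finset.sum_const, nsmul_eq_mul, Finset.card_univ]
        field_simp

lemma le_nCount_of_mem_SAst {n : ℕ} (hn : 0 < n) {δ : ℝ}
    (hδ : δ < 1 / (2 * (Fintype.card G : ℝ))) {σ₀ : Config G n} (hσ : σ₀ ∈ SAst G n δ) (a : G) :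
    (n : ℝ) / (2 * Fintype.card G) ≤ nCount G σ₀ a := by
  have hn' : (0 : ℝ) < n := by exact_mod_cast hn
  have hQ : (0 : ℝ) < Fintype.card G := by exact_mod_cast Fintype.card_pos
  have habs : |(nCount G σ₀ a : ℝ) / n - 1 / (Fintype.card G : ℝ)| ≤ δ := by
    refine le_trans (Real.abs_le_sqrt ?_) hσ.2
    exact Finset.single_le_sum
      (f := fun a => ((nCount G σ₀ a : ℝ) / n - 1 / (Fintype.card G : ℝ)) ^ 2)
      (fun b _ => sq_nonneg _) (Finset.mem_univ a)
  have hhalf : 1 / (Fintype.card G : ℝ) = 2 * (1 / (2 * Fintype.card G)) := by field_simp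
  have hfrac : 1 / (2 * (Fintype.card G : ℝ)) ≤ (nCount G σ₀ a : ℝ) / n := by
    have := (abs_le.mp habs).1
    linarith
  rw [le_div_iff₀ hn'] at hfrac
  calc (n : ℝ) / (2 * Fintype.card G) = 1 / (2 * (Fintype.card G : ℝ)) * n := by ring
    _ ≤ _ := hfrac

lemma card_rowDev_gt_le {n : ℕ} (hn : 0 < n) {R : ℝ} (hR : 0 < R) (σ₀ : Config G n) (a : G)
    (ha : (n : ℝ) / (2 * Fintype.card G) ≤ nCount G σ₀ a) :
    ((Finset.univ.filter
      (fun τ : Config G n => R / Real.sqrt n < Real.sqrt (rowDev G σ₀ τ a))).card : ℝ) ≤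
      2 * (Fintype.card G : ℝ) ^ 2 * (Fintype.card G : ℝ) ^ n / R ^ 2 := by
  have hn' : (0 : ℝ) < n := by exact_mod_cast hn
  have hQ : (0 : ℝ) < Fintype.card G := by exact_mod_cast Fintype.card_pos
  have hN : (0 : ℝ) < nCount G σ₀ a := lt_of_lt_of_le (by positivity) ha
  have hmarkov : ((Finset.univ.filter
      (fun τ : Config G n => R / Real.sqrt n < Real.sqrt (rowDev G σ₀ τ a))).card : ℝ) *
        (R ^ 2 / n) ≤ ∑ τ : Config G n, rowDev G σ₀ τ a := by
    rw [← nsmul_eq_mul]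
    refine (Finset.card_nsmul_le_sum _ (fun τ => rowDev G σ₀ τ a) _ fun τ hτ => ?_).trans
      (Finset.sum_le_univ_sum_of_nonneg fun τ => Finset.sum_nonneg fun b _ => sq_nonneg _)
    have h := (Real.lt_sqrt (by positivity)).mp (Finset.mem_filter.mp hτ).2
    rw [div_pow, Real.sq_sqrt hn'.le] at h
    exact h.le
  have hbound : ((Finset.univ.filter
      (fun τ : Config G n => R / Real.sqrt n < Real.sqrt (rowDev G σ₀ τ a))).card : ℝ) *
        (R ^ 2 / n) ≤
      (Fintype.card G : ℝ) * (Fintype.card G : ℝ) ^ n / (n / (2 * Fintype.card G)) :=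
    (hmarkov.trans (sum_rowDev_le G σ₀ a (by exact_mod_cast hN))).trans (by gcongr)
  rw [← le_div_iff₀ (by positivity)] at hbound
  refine hbound.trans_eq ?_
  field_simp

end Helpers

end PR

/-- Lemma 2.6, second part: there are constants `C_G` and `m` depending
only on `G` such that for every `0 < δ < 1/(2Q)`, every `R > 0` and all `n > m`,
`max_{σ_* ∈ S_*(δ)} π(σ ∉ S_*(σ_*, R/√n)) ≤ 2 C_G Q / R²`. -/
theorem stationary_concentration_matrix
    (G : Type) [Group G] [Fintype G] :
    ∃ (C : ℝ) (m : ℕ), ∀ δ : ℝ, 0 < δ → δ < 1 / (2 * (Fintype.card G : ℝ)) →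
      ∀ R : ℝ, 0 < R → ∀ n : ℕ, m < n →
        ∀ σast ∈ PR.SAst G n δ,
          (∑ τ ∈ Finset.univ.filter
              (fun τ : PR.Config G n => τ ∉ PR.SAstM G σast (R / Real.sqrt n)),
              PR.statDist G n τ)
            ≤ 2 * C * (Fintype.card G : ℝ) / R ^ 2 := by
  refine ⟨(Fintype.card G : ℝ) ^ 2 * (Fintype.card G : ℝ) ^ Fintype.card G, Fintype.card G,
    fun δ _ hδ R hR n hn σast hσ => ?_⟩
  have hn0 : 0 < n := by omega
  have hQ : (0 : ℝ) < Fintype.card G := by exact_mod_cast Fintype.card_pos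
  set S := Finset.univ.filter (fun τ : PR.Config G n => τ ∈ PR.gens G n) with hS
  set bad : G → Finset (PR.Config G n) := fun a => Finset.univ.filter
    (fun τ => R / Real.sqrt n < Real.sqrt (PR.rowDev G σast τ a))
  have hgens : (Fintype.card G : ℝ) ^ n ≤ S.card * (Fintype.card G : ℝ) ^ Fintype.card G := by
    exact_mod_cast PR.card_config_le_card_gens_mul G hn.le
  have hSpos : (0 : ℝ) < S.card :=
    pos_of_mul_pos_left (lt_of_lt_of_le (by positivity) hgens) (by positivity)
  have hcard : ((Finset.univ.biUnion bad).card : ℝ) ≤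
      Fintype.card G * (2 * (Fintype.card G : ℝ) ^ 2 * (Fintype.card G : ℝ) ^ n / R ^ 2) := by
    calc ((Finset.univ.biUnion bad).card : ℝ) ≤ ∑ a : G, ((bad a).card : ℝ) := by
          exact_mod_cast Finset.card_biUnion_le
      _ ≤ ∑ _a : G, 2 * (Fintype.card G : ℝ) ^ 2 * (Fintype.card G : ℝ) ^ n / R ^ 2 :=
          Finset.sum_le_sum fun a _ => PR.card_rowDev_gt_le G hn0 hR σast a
            (PR.le_nCount_of_mem_SAst G hn0 hδ hσ a)
      _ = _ := by simp
  have hsum : (∑ τ ∈ Finset.univ.filter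
      (fun τ : PR.Config G n => τ ∉ PR.SAstM G σast (R / Real.sqrt n)), PR.statDist G n τ)
      ≤ ((Finset.univ.biUnion bad).card : ℝ) * (1 / S.card) := by
    rw [← nsmul_eq_mul, ← Finset.sum_const, ← Finset.sum_filter_add_sum_filter_not _
      (fun τ => τ ∈ PR.gens G n), Finset.sum_eq_zero (s := Finset.filter (fun τ => ¬ _) _)
      (fun τ hτ => by simp [PR.statDist, (Finset.mem_filter.mp hτ).2]), add_zero]
    refine (Finset.sum_le_sum (g := fun _ => 1 / (S.card : ℝ)) fun τ hτ => ?_).trans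
      (Finset.sum_le_sum_of_subset_of_nonneg (fun τ hτ => ?_) fun _ _ _ => by positivity)
    · simp [PR.statDist, (Finset.mem_filter.mp hτ).2, hS]
    · simp only [Finset.mem_filter, Finset.mem_univ, true_and] at hτ
      by_contra hcon
      refine hτ.1 ⟨hτ.2, fun a => ?_⟩
      by_contra hlt
      exact hcon (Finset.mem_biUnion.mpr ⟨a, Finset.mem_univ a,
        Finset.mem_filter.mpr ⟨Finset.mem_univ τ, not_le.mp hlt⟩⟩)
  refine hsum.trans ?_
  rw [mul_one_div, div_le_iff₀ hSpos]
  calc ((Finset.univ.biUnion bad).card : ℝ)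
      ≤ Fintype.card G * (2 * (Fintype.card G : ℝ) ^ 2 *
          (S.card * (Fintype.card G : ℝ) ^ Fintype.card G) / R ^ 2) :=
        hcard.trans (by gcongr)
    _ = _ := by ring
end
end
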